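/- Assume 2 is invertible in R. Let J ⊆ A be the ideal of A generated by I_+ (equivalently, by the elements x^γ + y^γ with γ ∈ {0,1}^t, γ ≠ 0). Then J ⊆ I_A, and there exists n ≥ 1 such that I_A^n ⊆ J; consequently the I_A-adic and J-adic topologies on A coincide. (This is the split-torus, trivial-action case of the Filtration Lemma 3.1: the I-adic and IO-adic topologies on the representation ring of a split torus coincide.) -/

import Mathlib

noncomputable section

open MvPolynomial

/-- The defining ideal: generated by `x_i y_i + x_i + y_i`, `i = 1,…,t`. -/
def torusRel (R : Type*) [CommRing R] (t : ℕ) : Ideal (MvPolynomial (Fin t ⊕ Fin t) R) :=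
  Ideal.span { p | ∃ i : Fin t,
    p = X (Sum.inl i) * X (Sum.inr i) + X (Sum.inl i) + X (Sum.inr i) }

/-- `A = R[x_1,…,x_t,y_1,…,y_t]/(x_i y_i + x_i + y_i)`. -/
abbrev QA (R : Type*) [CommRing R] (t : ℕ) :=
  MvPolynomial (Fin t ⊕ Fin t) R ⧸ torusRel R t

/-- The image of the variable `x_i` in `A`. -/
def xg (R : Type*) [CommRing R] (t : ℕ) (i : Fin t) : QA R t :=
  Ideal.Quotient.mk _ (X (Sum.inl i))

/-- The image of the variable `y_i` in `A`. -/
def yg (R : Type*) [CommRing R] (t : ℕ) (i : Fin t) : QA R t :=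
  Ideal.Quotient.mk _ (X (Sum.inr i))

/-- `L = R[ℤ^t]`, the group algebra of `ℤ^t` over `R`. -/
abbrev LA (R : Type*) [CommRing R] (t : ℕ) := AddMonoidAlgebra R (Fin t → ℤ)

/-- The basis element `u^ν` of `L = R[ℤ^t]`. -/
def uL (R : Type*) [CommRing R] (t : ℕ) (ν : Fin t → ℤ) : LA R t :=
  AddMonoidAlgebra.single ν 1

/-- The ideal `I_A ⊆ A` generated by `x_1,…,x_t,y_1,…,y_t`. -/
def IA (R : Type*) [CommRing R] (t : ℕ) : Ideal (QA R t) :=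
  Ideal.span (Set.range (xg R t) ∪ Set.range (yg R t))

set_option synthInstance.maxHeartbeats 1000000

theorem xg_mul_yg (R : Type*) [CommRing R] (t : ℕ) (i : Fin t) :
    xg R t i * yg R t i = -(xg R t i + yg R t i) := by
  have h : Ideal.Quotient.mk (torusRel R t)
      (X (Sum.inl i) * X (Sum.inr i) + X (Sum.inl i) + X (Sum.inr i)) = 0 :=
    Ideal.Quotient.eq_zero_iff_mem.mpr (Ideal.subset_span ⟨i, rfl⟩)
  rw [map_add, map_add, map_mul] at h
  change xg R t i * yg R t i + xg R t i + yg R t i = 0 at h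
  linear_combination h

theorem IA_fg (R : Type*) [CommRing R] (t : ℕ) : (IA R t).FG :=
  Submodule.fg_span ((Set.finite_range _).union (Set.finite_range _))

/-- Assume `2` is invertible in `R`, and let `J` be the ideal of `A` generated by
`I_+ = {a ∈ I_A : τ(a) = a}`.  Then `J ⊆ I_A` and some power of `I_A` is contained
in `J`, so the `I_A`-adic and `J`-adic topologies on `A` coincide. -/
theorem stmt9 (R : Type*) [CommRing R] (t : ℕ) (ht : 1 ≤ t) (h2 : IsUnit (2 : R))
    (τ : QA R t ≃ₐ[R] QA R t)
    (hτx : ∀ i : Fin t, τ (xg R t i) = yg R t i)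
    (hτy : ∀ i : Fin t, τ (yg R t i) = xg R t i) :
    Ideal.span {a : QA R t | a ∈ IA R t ∧ τ a = a} ≤ IA R t ∧
    ∃ n : ℕ, 1 ≤ n ∧
      IA R t ^ n ≤ Ideal.span {a : QA R t | a ∈ IA R t ∧ τ a = a} := by
  have hx (i : Fin t) : xg R t i ∈ IA R t := Ideal.subset_span (Or.inl ⟨i, rfl⟩)
  have hy (i : Fin t) : yg R t i ∈ IA R t := Ideal.subset_span (Or.inr ⟨i, rfl⟩)
  refine ⟨Ideal.span_le.mpr fun a ha => ha.1, ?_⟩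
  set J := Ideal.span {a : QA R t | a ∈ IA R t ∧ τ a = a} with hJ
  have hadd (i : Fin t) : xg R t i + yg R t i ∈ J :=
    Ideal.subset_span ⟨add_mem (hx i) (hy i), by rw [map_add, hτx, hτy, add_comm]⟩
  have hrad : IA R t ≤ J.radical := by
    refine Ideal.span_le.mpr ?_
    rintro _ (⟨i, rfl⟩ | ⟨i, rfl⟩)
    · refine ⟨2, ?_⟩
      rw [show xg R t i ^ 2 = (xg R t i + 1) * (xg R t i + yg R t i) by
        linear_combination -xg_mul_yg R t i]
      exact J.mul_mem_left _ (hadd i)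
    · refine ⟨2, ?_⟩
      rw [show yg R t i ^ 2 = (yg R t i + 1) * (xg R t i + yg R t i) by
        linear_combination -xg_mul_yg R t i]
      exact J.mul_mem_left _ (hadd i)
  obtain ⟨n, hn⟩ := Ideal.exists_pow_le_of_le_radical_of_fg hrad (IA_fg R t)
  exact ⟨n + 1, n.succ_pos, (Ideal.pow_le_pow_right n.le_succ).trans hn⟩
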